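/- For given (v, n, ε), let (Q, \hat P_n) and (Q', \hat P'_n) be RPBD schemes with parameters (v,b,r,λ,ε) and (v,b',r',λ',ε), respectively. Then the two schemes are marginally equivalent if and only if there exists a constant t > 0 such that (b', r', λ') = t·(b, r, λ); i.e., marginal equivalence holds exactly when the ratios [b : r : λ] and [b' : r' : λ'] coincide. -/

import Mathlib

open Finset Real
open scoped Classical

noncomputable section

/-- The "row" of an incidence structure: outputs incident to input `x`. -/
def Ix {v : ℕ} {Y : Type*} [Fintype Y] [DecidableEq Y]
    (I : Finset (Fin v × Y)) (x : Fin v) : Finset Y :=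
  Finset.univ.filter (fun y => (x, y) ∈ I)

/-- The "column" of an incidence structure: inputs incident to output `y`. -/
def Iy {v : ℕ} {Y : Type*} [Fintype Y] [DecidableEq Y]
    (I : Finset (Fin v × Y)) (y : Y) : Finset (Fin v) :=
  Finset.univ.filter (fun x => (x, y) ∈ I)

/-- A `(v,b,r,lam)`-regular pairwise-balanced design (RPBD). -/
def IsRPBD {v : ℕ} {Y : Type*} [Fintype Y] [DecidableEq Y]
    (I : Finset (Fin v × Y)) (b r lam : ℕ) : Prop :=
  0 < v ∧ Fintype.card Y = b ∧ lam < r ∧ r < b ∧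
    (∀ x : Fin v, (Ix I x).card = r) ∧
    (∀ x x' : Fin v, x ≠ x' → (Ix I x ∩ Ix I x').card = lam)

/-- A `(v,b,r,k,lam)`-block design: an RPBD that is moreover `k`-uniform, with `0 < k < v`. -/
def IsBlockDesign {v : ℕ} {Y : Type*} [Fintype Y] [DecidableEq Y]
    (I : Finset (Fin v × Y)) (b r k lam : ℕ) : Prop :=
  IsRPBD I b r lam ∧ 0 < k ∧ k < v ∧ ∀ y : Y, (Iy I y).card = k

/-- The (block design / RPBD) privacy mechanism: output `y` has probability `α e^ε` if
`(x,y) ∈ I` and `α` otherwise, where `α = 1/(r e^ε + b - r)`. -/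
def mechQ {v : ℕ} {Y : Type*} [Fintype Y] [DecidableEq Y]
    (I : Finset (Fin v × Y)) (b r : ℕ) (ε : ℝ) (x : Fin v) (y : Y) : ℝ :=
  if (x, y) ∈ I then Real.exp ε / ((r : ℝ) * Real.exp ε + (b : ℝ) - (r : ℝ))
  else 1 / ((r : ℝ) * Real.exp ε + (b : ℝ) - (r : ℝ))

/-- The probability simplex `Δ_v` on `{1,…,v}`. -/
def simplex (v : ℕ) : Set (Fin v → ℝ) :=
  {P | (∀ x, 0 ≤ P x) ∧ ∑ x, P x = 1}

/-- Marginal distribution of a single privatized output `Y` when `X ~ P`, `Y ~ Q(·|X)`. -/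
def outDist {v : ℕ} {Y : Type*} [Fintype Y] (P : Fin v → ℝ) (Q : Fin v → Y → ℝ) (y : Y) : ℝ :=
  ∑ x, P x * Q x y

/-- Joint probability of the i.i.d. outputs `(Y_1,…,Y_n)`. -/
def jointW {v n : ℕ} {Y : Type*} [Fintype Y] (P : Fin v → ℝ) (Q : Fin v → Y → ℝ)
    (ys : Fin n → Y) : ℝ :=
  ∏ i, outDist P Q (ys i)

/-- The count `N_x(Y_1,…,Y_n) = Σ_i 1(Y_i ∈ ℐ_x)`. -/
def Nx {v n : ℕ} {Y : Type*} [Fintype Y] [DecidableEq Y]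
    (I : Finset (Fin v × Y)) (x : Fin v) (ys : Fin n → Y) : ℕ :=
  (Finset.univ.filter (fun i => ys i ∈ Ix I x)).card

/-- The canonical (unbiased) estimator of an RPBD scheme. -/
def canonEst {v n : ℕ} {Y : Type*} [Fintype Y] [DecidableEq Y]
    (I : Finset (Fin v × Y)) (b r lam : ℕ) (ε : ℝ) (x : Fin v) (ys : Fin n → Y) : ℝ :=
  (1 / (((r : ℝ) - (lam : ℝ)) * (Real.exp ε - 1))) *
    ((Nx I x ys : ℝ) * ((r : ℝ) * Real.exp ε + (b : ℝ) - (r : ℝ)) / (n : ℝ)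
      - ((lam : ℝ) * Real.exp ε + ((r : ℝ) - (lam : ℝ))))

/-- The squared `ℓ_2` loss. -/
def l2loss (v : ℕ) (p phat : Fin v → ℝ) : ℝ := ∑ x, (p x - phat x) ^ 2

/-- The risk `R_{v,n}(ℓ, P, Q, P̂_n) = E[ℓ(P, P̂_n(Y_1,…,Y_n))]`. -/
def risk {v : ℕ} {Y : Type*} [Fintype Y] (n : ℕ) (P : Fin v → ℝ) (Q : Fin v → Y → ℝ)
    (L : (Fin v → ℝ) → (Fin v → ℝ) → ℝ) (est : Fin v → (Fin n → Y) → ℝ) : ℝ :=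
  ∑ ys : Fin n → Y, jointW P Q ys * L P (fun x => est x ys)

/-- Marginal equivalence of two schemes: for every `P ∈ Δ_v` and coordinate `x`, the
estimators `P̂_{n,x}` and `P̂'_{n,x}` have the same distribution. -/
def MargEquiv {v : ℕ} {Y Y' : Type*} [Fintype Y] [Fintype Y'] (n : ℕ)
    (Q : Fin v → Y → ℝ) (est : Fin v → (Fin n → Y) → ℝ)
    (Q' : Fin v → Y' → ℝ) (est' : Fin v → (Fin n → Y') → ℝ) : Prop :=
  ∀ P ∈ simplex v, ∀ x : Fin v, ∀ t : ℝ,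
    (∑ ys : Fin n → Y, if est x ys = t then jointW P Q ys else 0)
      = ∑ ys : Fin n → Y', if est' x ys = t then jointW P Q' ys else 0

section Helpers

variable {v n b r lam : ℕ} {Y : Type*} [Fintype Y]

lemma MargEquiv.symm {Y' : Type*} [Fintype Y'] {Q : Fin v → Y → ℝ}
    {est : Fin v → (Fin n → Y) → ℝ} {Q' : Fin v → Y' → ℝ} {est' : Fin v → (Fin n → Y') → ℝ}
    (hm : MargEquiv n Q est Q' est') : MargEquiv n Q' est' Q est :=
  fun P hP x t => (hm P hP x t).symm

/-- Every value attained by the first estimator with positive probability is attained by the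
second one. -/
lemma MargEquiv.exists_est_eq {Y' : Type*} [Fintype Y'] {Q : Fin v → Y → ℝ}
    {est : Fin v → (Fin n → Y) → ℝ} {Q' : Fin v → Y' → ℝ} {est' : Fin v → (Fin n → Y') → ℝ}
    (hm : MargEquiv n Q est Q' est') {P : Fin v → ℝ} (hP : P ∈ simplex v)
    (hpos : ∀ y, 0 < outDist P Q y) (x : Fin v) (ys : Fin n → Y) :
    ∃ ys', est' x ys' = est x ys := by
  by_contra! hne
  have hsum := hm P hP x (est x ys)
  rw [Finset.sum_eq_zero (f := fun ys' => if est' x ys' = est x ys then jointW P Q' ys' else 0)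
    fun ys' _ => if_neg (hne ys')] at hsum
  have hw : ∀ zs : Fin n → Y, 0 < jointW P Q zs := fun zs => Finset.prod_pos fun i _ => hpos _
  refine hsum.not_gt (Finset.sum_pos' (fun zs _ => ?_) ⟨ys, mem_univ _, ?_⟩)
  · split_ifs
    exacts [(hw zs).le, le_rfl]
  · simpa using hw ys

variable [DecidableEq Y]

/-- The law of the number of samples falling in `S` depends on the weights only through the total
weights of `S` and of its complement. -/
lemma sum_card_mem_mul_prod (F : ℕ → ℝ) (w : Y → ℝ) (S : Finset Y) :
    ∑ ys : Fin n → Y, F (univ.filter fun i => ys i ∈ S).card * ∏ i, w (ys i)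
      = ∑ T : Finset (Fin n), F T.card *
          ∏ i, if i ∈ T then ∑ y ∈ S, w y else ∑ y ∈ Sᶜ, w y := by
  rw [← Finset.sum_fiberwise univ fun ys : Fin n → Y => univ.filter fun i => ys i ∈ S]
  refine Finset.sum_congr rfl fun T _ => ?_
  have hprod : (∏ i, if i ∈ T then ∑ y ∈ S, w y else ∑ y ∈ Sᶜ, w y)
      = ∑ ys ∈ univ.filter (fun ys : Fin n → Y => (univ.filter fun i => ys i ∈ S) = T),
          ∏ i, w (ys i) := by
    have hite : ∀ i, (if i ∈ T then ∑ y ∈ S, w y else ∑ y ∈ Sᶜ, w y)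
        = ∑ y ∈ (if i ∈ T then S else Sᶜ), w y := fun i => by split_ifs <;> rfl
    simp_rw [hite]
    rw [Finset.prod_univ_sum]
    refine Finset.sum_congr ?_ fun _ _ => rfl
    ext ys
    simp only [Fintype.mem_piFinset, mem_filter, mem_univ, true_and, Finset.ext_iff]
    refine forall_congr' fun i => ?_
    by_cases hi : i ∈ T <;> simp [hi]
  rw [hprod, Finset.mul_sum]
  refine Finset.sum_congr rfl fun ys hys => ?_
  rw [(mem_filter.mp hys).2]

/-- The canonical estimator, as a function of the count `N_x`. -/
def canonVal (n b r lam : ℕ) (ε : ℝ) (k : ℕ) : ℝ :=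
  (1 / (((r : ℝ) - (lam : ℝ)) * (Real.exp ε - 1))) *
    ((k : ℝ) * ((r : ℝ) * Real.exp ε + (b : ℝ) - (r : ℝ)) / (n : ℝ)
      - ((lam : ℝ) * Real.exp ε + ((r : ℝ) - (lam : ℝ))))

lemma canonEst_eq_canonVal (I : Finset (Fin v × Y)) (ε : ℝ) (x : Fin v) (ys : Fin n → Y) :
    canonEst I b r lam ε x ys = canonVal n b r lam ε (Nx I x ys) := rfl

lemma normalizer_pos (hrb : r < b) (ε : ℝ) :
    0 < (r : ℝ) * Real.exp ε + (b : ℝ) - (r : ℝ) := by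
  have : (r : ℝ) < b := by exact_mod_cast hrb
  have : 0 ≤ (r : ℝ) * Real.exp ε := by positivity
  linarith

lemma canonVal_mono (hlr : lam < r) (hrb : r < b) {ε : ℝ} (hε : 0 < ε) :
    Monotone (canonVal n b r lam ε) := by
  intro k l hkl
  have hE : 0 < Real.exp ε - 1 := by linarith [Real.add_one_lt_exp hε.ne']
  have hrl : (0 : ℝ) < r - lam := sub_pos.mpr (by exact_mod_cast hlr)
  have hD := normalizer_pos hrb ε
  unfold canonVal
  gcongr

lemma outDist_mechQ_pos (I : Finset (Fin v × Y)) (hrb : r < b) (ε : ℝ) {P : Fin v → ℝ}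
    (hP : P ∈ simplex v) (y : Y) : 0 < outDist P (mechQ I b r ε) y := by
  have hD := normalizer_pos hrb ε
  have hQ : ∀ x, 0 < mechQ I b r ε x y := fun x => by
    unfold mechQ
    split_ifs <;> positivity
  have hne : ∃ x ∈ univ, 0 < P x := by
    by_contra! hP0
    have := Finset.sum_nonpos hP0
    linarith [hP.2]
  obtain ⟨x, hx, hPx⟩ := hne
  exact Finset.sum_pos' (fun x _ => mul_nonneg (hP.1 x) (hQ x).le) ⟨x, hx, mul_pos hPx (hQ x)⟩

lemma exists_Nx_eq_zero (I : Finset (Fin v × Y)) (h : IsRPBD I b r lam) (x : Fin v) :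
    ∃ ys : Fin n → Y, Nx I x ys = 0 := by
  obtain ⟨-, hb, -, hrb, hr, -⟩ := h
  obtain ⟨y, hy⟩ : ∃ y, y ∉ Ix I x := by
    by_contra! hall
    rw [← hr x, Finset.eq_univ_of_forall hall, Finset.card_univ] at hrb
    omega
  exact ⟨fun _ => y, by simp [Nx, hy]⟩

lemma exists_Nx_eq_card (I : Finset (Fin v × Y)) (h : IsRPBD I b r lam) (x : Fin v) :
    ∃ ys : Fin n → Y, Nx I x ys = n := by
  obtain ⟨-, -, hlr, -, hr, -⟩ := h
  obtain ⟨y, hy⟩ : (Ix I x).Nonempty := by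
    rw [← Finset.card_pos, hr x]
    omega
  exact ⟨fun _ => y, by simp [Nx, hy]⟩

lemma Nx_le (I : Finset (Fin v × Y)) (x : Fin v) (ys : Fin n → Y) : Nx I x ys ≤ n := by
  simpa [Nx] using Finset.card_le_univ (univ.filter fun i => ys i ∈ Ix I x)

lemma MargEquiv.canonVal_le {b' r' lam' : ℕ} {Y' : Type*} [Fintype Y'] [DecidableEq Y']
    {I : Finset (Fin v × Y)} {I' : Finset (Fin v × Y')}
    (h : IsRPBD I b r lam) (h' : IsRPBD I' b' r' lam') {ε : ℝ} (hε : 0 < ε)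
    (hm : MargEquiv n (mechQ I b r ε) (canonEst I b r lam ε)
        (mechQ I' b' r' ε) (canonEst I' b' r' lam' ε)) :
    canonVal n b' r' lam' ε 0 ≤ canonVal n b r lam ε 0 ∧
      canonVal n b r lam ε n ≤ canonVal n b' r' lam' ε n := by
  let x : Fin v := ⟨0, h.1⟩
  have hP : Pi.single x 1 ∈ simplex v :=
    ⟨fun z => by by_cases hz : z = x <;> simp [hz], by simp⟩
  have hmono := canonVal_mono (n := n) h'.2.2.1 h'.2.2.2.1 hε
  have key := hm.exists_est_eq hP (outDist_mechQ_pos I h.2.2.2.1 ε hP) x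
  constructor
  · obtain ⟨ys, hys⟩ := exists_Nx_eq_zero (n := n) I h x
    obtain ⟨ys', he⟩ := key ys
    rw [canonEst_eq_canonVal, canonEst_eq_canonVal, hys] at he
    exact he ▸ hmono (Nat.zero_le _)
  · obtain ⟨ys, hys⟩ := exists_Nx_eq_card (n := n) I h x
    obtain ⟨ys', he⟩ := key ys
    rw [canonEst_eq_canonVal, canonEst_eq_canonVal, hys] at he
    exact he ▸ hmono (Nx_le I' x ys')

lemma sum_mechQ (I : Finset (Fin v × Y)) (ε : ℝ) (x : Fin v) (S : Finset Y) :
    ∑ y ∈ S, mechQ I b r ε x y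
      = ((S ∩ Ix I x).card * (Real.exp ε - 1) + S.card)
          / ((r : ℝ) * Real.exp ε + (b : ℝ) - (r : ℝ)) := by
  have hQ : ∀ y, mechQ I b r ε x y = ((if y ∈ Ix I x then Real.exp ε - 1 else 0) + 1)
      / ((r : ℝ) * Real.exp ε + (b : ℝ) - (r : ℝ)) := fun y => by
    by_cases hy : (x, y) ∈ I <;> simp [mechQ, Ix, hy]
  simp_rw [hQ]
  rw [← Finset.sum_div, Finset.sum_add_distrib, Finset.sum_ite_mem]
  simp only [Finset.sum_const, nsmul_eq_mul, mul_one]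

lemma sum_outDist_mechQ (I : Finset (Fin v × Y)) (h : IsRPBD I b r lam) (ε : ℝ)
    (P : Fin v → ℝ) (x : Fin v) :
    ∑ y ∈ Ix I x, outDist P (mechQ I b r ε) y
      = ∑ z, P z * (((if z = x then (r : ℝ) else lam) * (Real.exp ε - 1) + r)
          / ((r : ℝ) * Real.exp ε + (b : ℝ) - (r : ℝ))) := by
  obtain ⟨-, -, -, -, hr, hlam⟩ := h
  unfold outDist
  rw [Finset.sum_comm]
  refine Finset.sum_congr rfl fun z _ => ?_
  rw [← Finset.mul_sum, sum_mechQ, hr x]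
  by_cases hz : z = x
  · subst hz
    simp [hr z]
  · simp [hz, hlam x z (Ne.symm hz)]

lemma sum_univ_outDist_mechQ (I : Finset (Fin v × Y)) (h : IsRPBD I b r lam) (ε : ℝ)
    (P : Fin v → ℝ) : ∑ y, outDist P (mechQ I b r ε) y = ∑ z, P z := by
  obtain ⟨-, hb, -, hrb, hr, -⟩ := h
  have hD := normalizer_pos hrb ε
  unfold outDist
  rw [Finset.sum_comm]
  refine Finset.sum_congr rfl fun z _ => ?_
  rw [← Finset.mul_sum, sum_mechQ, Finset.univ_inter, hr z, Finset.card_univ, hb]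
  have : (r : ℝ) * (Real.exp ε - 1) + b = (r : ℝ) * Real.exp ε + b - r := by ring
  rw [this, div_self hD.ne', mul_one]

lemma sum_ite_canonEst (I : Finset (Fin v × Y)) (ε : ℝ) (P : Fin v → ℝ) (Q : Fin v → Y → ℝ)
    (x : Fin v) (t : ℝ) :
    (∑ ys : Fin n → Y, if canonEst I b r lam ε x ys = t then jointW P Q ys else 0)
      = ∑ T : Finset (Fin n), (if canonVal n b r lam ε T.card = t then 1 else 0) *
          ∏ i, if i ∈ T then ∑ y ∈ Ix I x, outDist P Q y
            else ∑ y, outDist P Q y - ∑ y ∈ Ix I x, outDist P Q y := by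
  have hc : ∑ y, outDist P Q y - ∑ y ∈ Ix I x, outDist P Q y
      = ∑ y ∈ (Ix I x)ᶜ, outDist P Q y := by
    rw [← Finset.sum_add_sum_compl (Ix I x), add_sub_cancel_left]
  rw [hc, ← sum_card_mem_mul_prod (fun k => if canonVal n b r lam ε k = t then 1 else 0)]
  refine Finset.sum_congr rfl fun ys _ => ?_
  rw [canonEst_eq_canonVal, ite_mul, one_mul, zero_mul]
  rfl

end Helpers

/-- Two RPBD schemes with parameters `(v,b,r,lam,ε)` and
`(v,b',r',lam',ε)` are marginally equivalent iff `(b',r',lam') = t·(b,r,lam)` for some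
`t > 0`, i.e. iff the ratios `[b : r : lam]` and `[b' : r' : lam']` coincide. -/
theorem rpbd_marg_equiv_iff {v n b r lam b' r' lam' : ℕ} (hn : 0 < n)
    {Y Y' : Type*} [Fintype Y] [DecidableEq Y] [Fintype Y'] [DecidableEq Y']
    (I : Finset (Fin v × Y)) (I' : Finset (Fin v × Y'))
    (h : IsRPBD I b r lam) (h' : IsRPBD I' b' r' lam')
    (ε : ℝ) (hε : 0 < ε) :
    MargEquiv n (mechQ I b r ε) (canonEst I b r lam ε)
        (mechQ I' b' r' ε) (canonEst I' b' r' lam' ε)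
      ↔ ∃ t : ℝ, 0 < t ∧ (b' : ℝ) = t * (b : ℝ) ∧ (r' : ℝ) = t * (r : ℝ)
          ∧ (lam' : ℝ) = t * (lam : ℝ) := by
  have hE : 0 < Real.exp ε - 1 := by linarith [Real.add_one_lt_exp hε.ne']
  have hrl : (0 : ℝ) < r - lam := sub_pos.mpr (by exact_mod_cast h.2.2.1)
  have hrl' : (0 : ℝ) < r' - lam' := sub_pos.mpr (by exact_mod_cast h'.2.2.1)
  have hn' : (n : ℝ) ≠ 0 := by exact_mod_cast hn.ne'
  constructor
  · intro hm
    obtain ⟨h0le, hnle⟩ := hm.canonVal_le h h' hε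
    obtain ⟨h0ge, hnge⟩ := hm.symm.canonVal_le h' h hε
    have h0 := h0le.antisymm h0ge
    have h1 := hnle.antisymm hnge
    unfold canonVal at h0 h1
    field_simp at h0 h1
    have hlam : (lam' : ℝ) * (r - lam) = lam * (r' - lam') := by
      have : n * Real.exp ε ≠ 0 := mul_ne_zero hn' (Real.exp_pos ε).ne'
      refine mul_right_cancel₀ this ?_
      push_cast at h0
      linear_combination -h0
    have hr : (r' : ℝ) * (r - lam) = r * (r' - lam') := by linarith
    refine ⟨(r' - lam') / (r - lam), by positivity, ?_, ?_, ?_⟩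
    · field_simp
      linear_combination (-1) * h1 - Real.exp ε * hr + Real.exp ε * hlam + hr
    · field_simp
      linarith
    · field_simp
      linarith
  · rintro ⟨t, ht, hb, hr, hlam⟩ P hP x s
    have hD := normalizer_pos h.2.2.2.1 ε
    have hval : canonVal n b' r' lam' ε = canonVal n b r lam ε := by
      ext k
      unfold canonVal
      have hrl2 : t * (r : ℝ) - t * lam ≠ 0 := by rw [← mul_sub]; positivity
      rw [hb, hr, hlam]
      field_simp
    have hp : ∑ y ∈ Ix I' x, outDist P (mechQ I' b' r' ε) y
        = ∑ y ∈ Ix I x, outDist P (mechQ I b r ε) y := by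
      rw [sum_outDist_mechQ I h, sum_outDist_mechQ I' h']
      refine Finset.sum_congr rfl fun z _ => ?_
      rw [hb, hr, hlam, ← mul_div_mul_left _ ((r : ℝ) * Real.exp ε + b - r) ht.ne']
      congr 2
      · split_ifs <;> ring
      · ring
    rw [sum_ite_canonEst, sum_ite_canonEst, hval, hp, sum_univ_outDist_mechQ I h,
      sum_univ_outDist_mechQ I' h']

end
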